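/- arXiv:2310.02279 — 3 statements merged into one kernel-verified Lean document; each statement's English description precedes it below -/
import Mathlib

section
/- Let 0 = t_0 < t_1 < ⋯ < t_N = T be a time grid with mesh Δ := max_{0≤n<N}(t_{n+1}−t_n). Let G : ℝ^D × [0,T] × [0,T] → ℝ^D be a flow satisfying G(x,t,t) = x and the semigroup property G(G(x,t,u),u,s) = G(x,t,s) for all s ≤ u ≤ t. Let G_θ : ℝ^D × [0,T] × [0,T] → ℝ^D satisfy G_θ(x,t,t) = x and be L₂-Lipschitz in x uniformly in the time arguments. Let Solver satisfy the uniform local truncation bound ‖Solver(x,t_{n+1},t_n) − G(x,t_{n+1},t_n)‖₂ ≤ C·(t_{n+1}−t_n)^{p+1} for all x and all n, with p ≥ 1. Assume the consistency equalities hold: for all x ∈ ℝ^D, all n with 0 ≤ n < N, and all m ≤ n, G_θ(x, t_{n+1}, t_m) = G_θ(Solver(x, t_{n+1}, t_n), t_n, t_m). Then for all n ∈ {1,…,N} and all m ≤ n, sup_{x∈ℝ^D} ‖G_θ(x,t_n,t_m) − G(x,t_n,t_m)‖₂ ≤ L₂·C·Δ^p·(t_n − t_m). -/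
/-- A finite sequence that strictly increases at each of its first `N` steps is monotone
on `{0, …, N}`. -/
theorem le_of_lt_succ_of_le {t : ℕ → ℝ} {N : ℕ} (hmono : ∀ n < N, t n < t (n + 1))
    {i j : ℕ} (hij : i ≤ j) (hj : j ≤ N) : t i ≤ t j := by
  induction j, hij using Nat.le_induction with
  | base => exact le_rfl
  | succ k _ ih => exact (ih (by omega)).trans (hmono k (by omega)).le

/-- Pointwise convergence of the consistency trajectory model along the
teacher flow: on a grid `0 = t 0 < ⋯ < t N = T` with mesh `Δ`, if the teacher flow `G`
satisfies the initial condition and semigroup property, `Gθ` satisfies the initial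
condition and is `L₂`-Lipschitz in `x` uniformly in times, the solver has local
truncation error `≤ C (t (n+1) - t n)^(p+1)`, and the consistency equalities hold, then
`‖Gθ x (t n) (t m) - G x (t n) (t m)‖ ≤ L₂ C Δ^p (t n - t m)` for all `x`, `1 ≤ n ≤ N`,
`m ≤ n`. -/
theorem stmt8 (d N : ℕ) (hN : 0 < N) (T : ℝ)
    (t : ℕ → ℝ) (ht0 : t 0 = 0) (htN : t N = T)
    (hmono : ∀ n < N, t n < t (n + 1))
    (Δ : ℝ)
    (hΔ : Δ = (Finset.range N).sup' (Finset.nonempty_range_iff.mpr hN.ne')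
      (fun n => t (n + 1) - t n))
    (G Gθ Solver : EuclideanSpace ℝ (Fin d) → ℝ → ℝ → EuclideanSpace ℝ (Fin d))
    (hGid : ∀ x, ∀ u ∈ Set.Icc (0:ℝ) T, G x u u = x)
    (hGsemi : ∀ x, ∀ s u v : ℝ, 0 ≤ s → s ≤ u → u ≤ v → v ≤ T →
      G (G x v u) u s = G x v s)
    (hGθid : ∀ x, ∀ u ∈ Set.Icc (0:ℝ) T, Gθ x u u = x)
    (L₂ : NNReal)
    (hGθlip : ∀ u ∈ Set.Icc (0:ℝ) T, ∀ s ∈ Set.Icc (0:ℝ) T,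
      LipschitzWith L₂ (fun x => Gθ x u s))
    (C : ℝ) (p : ℕ) (hp : 1 ≤ p)
    (hSolver : ∀ x, ∀ n < N,
      ‖Solver x (t (n + 1)) (t n) - G x (t (n + 1)) (t n)‖ ≤ C * (t (n + 1) - t n) ^ (p + 1))
    (hcons : ∀ x, ∀ n < N, ∀ m ≤ n,
      Gθ x (t (n + 1)) (t m) = Gθ (Solver x (t (n + 1)) (t n)) (t n) (t m)) :
    ∀ n, 1 ≤ n → n ≤ N → ∀ m ≤ n, ∀ x,
      ‖Gθ x (t n) (t m) - G x (t n) (t m)‖ ≤ (L₂ : ℝ) * C * Δ ^ p * (t n - t m) := by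
  have hmem : ∀ k ≤ N, t k ∈ Set.Icc (0 : ℝ) T := fun k hk =>
    ⟨ht0 ▸ le_of_lt_succ_of_le hmono k.zero_le hk, htN ▸ le_of_lt_succ_of_le hmono hk le_rfl⟩
  have hstep : ∀ k < N, t (k + 1) - t k ≤ Δ := fun k hk => by
    rw [hΔ]
    exact Finset.le_sup' (fun n => t (n + 1) - t n) (Finset.mem_range.mpr hk)
  have hC : 0 ≤ C := nonneg_of_mul_nonneg_left ((norm_nonneg _).trans (hSolver 0 0 hN))
    (pow_pos (sub_pos.mpr (hmono 0 hN)) _)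
  intro n _ hn m hmn
  induction n, hmn using Nat.le_induction with
  | base =>
    intro x
    simp [hGid x _ (hmem m hn), hGθid x _ (hmem m hn)]
  | succ k hmk ih =>
    intro x
    have hk : k < N := hn
    have ih' : ∀ y, ‖Gθ y (t k) (t m) - G y (t k) (t m)‖
        ≤ (L₂ : ℝ) * C * Δ ^ p * (t k - t m) := by
      intro y
      rcases Nat.eq_zero_or_pos k with rfl | hpos
      · obtain rfl : m = 0 := Nat.le_zero.mp hmk
        simp [hGid y _ (hmem 0 hk.le), hGθid y _ (hmem 0 hk.le)]
      · exact ih hpos hk.le y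
    have hpos : 0 < t (k + 1) - t k := sub_pos.mpr (hmono k hk)
    have hlocal : ‖Solver x (t (k + 1)) (t k) - G x (t (k + 1)) (t k)‖
        ≤ C * (Δ ^ p * (t (k + 1) - t k)) := by
      refine (hSolver x k hk).trans ?_
      rw [pow_succ]
      have := hstep k hk
      gcongr
    have hlip := (hGθlip (t k) (hmem k hk.le) (t m) (hmem m (hmk.trans hk.le))).norm_sub_le
      (Solver x (t (k + 1)) (t k)) (G x (t (k + 1)) (t k))
    rw [hcons x k hk m hmk, ← hGsemi x (t m) (t k) (t (k + 1)) (hmem m (hmk.trans hk.le)).1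
      (le_of_lt_succ_of_le hmono hmk hk.le) (hmono k hk).le (hmem (k + 1) hn).2]
    calc _ ≤ _ := norm_sub_le_norm_sub_add_norm_sub _
          (Gθ (G x (t (k + 1)) (t k)) (t k) (t m)) _
      _ ≤ (L₂ : ℝ) * (C * (Δ ^ p * (t (k + 1) - t k)))
          + (L₂ : ℝ) * C * Δ ^ p * (t k - t m) :=
        add_le_add (hlip.trans (mul_le_mul_of_nonneg_left hlocal L₂.coe_nonneg)) (ih' _)
      _ = _ := by ring
end

section
/- Let 0 = t_0 < t_1 < ⋯ < t_N = T be a time grid with mesh Δ := max_{0≤n<N}(t_{n+1}−t_n). Let F : ℝ^D → ℝ^m be L₁-Lipschitz. Let G : ℝ^D × [0,T] × [0,T] → ℝ^D be a flow satisfying G(x,t,t) = x and G(G(x,t,u),u,s) = G(x,t,s) for all s ≤ u ≤ t. Let G_θ : ℝ^D × [0,T] × [0,T] → ℝ^D satisfy G_θ(x,t,t) = x and be L₂-Lipschitz in x uniformly in the time arguments. Let Solver satisfy ‖Solver(x,t_{n+1},t_n) − G(x,t_{n+1},t_n)‖₂ ≤ C·(t_{n+1}−t_n)^{p+1} for all x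 and all n, with p ≥ 1. Assume that for all x ∈ ℝ^D, all n with 0 ≤ n < N, and all m ≤ n, F(G_θ(G_θ(x,t_{n+1},t_m),t_m,0)) = F(G_θ(G_θ(Solver(x,t_{n+1},t_n),t_n,t_m),t_m,0)). Then for all n ∈ {1,…,N} and all m ≤ n, sup_{x∈ℝ^D} ‖F(G_θ(G_θ(x,t_n,t_m),t_m,0)) − F(G_θ(G(x,t_n,t_m),t_m,0))‖_q ≤ L₁·L₂²·C·Δ^p·(t_n − t_m). -/
/-- Convergence of the consistency trajectory model in feature (LPIPS-like)
distance `d(x,y) = ‖F x - F y‖_q` induced by an `L₁`-Lipschitz feature extractor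
`F : ℝ^D → ℝ^m` (with `ℓ_q` norm, `q ≥ 1`): on a grid `0 = t 0 < ⋯ < t N = T` with mesh
`Δ`, if the teacher flow `G` satisfies the initial condition and semigroup property, `Gθ`
satisfies the initial condition and is `L₂`-Lipschitz in `x` uniformly in times, the
solver has local truncation error `≤ C (t(n+1) - t n)^(p+1)`, and the consistency
equalities in feature space hold, then for all `1 ≤ n ≤ N`, `m ≤ n`, and all `x`,
`‖F (Gθ (Gθ x (t n) (t m)) (t m) 0) - F (Gθ (G x (t n) (t m)) (t m) 0)‖_q
  ≤ L₁ L₂² C Δ^p (t n - t m)`. -/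
theorem stmt9 (d N : ℕ) (hN : 0 < N) (T : ℝ)
    (t : ℕ → ℝ) (ht0 : t 0 = 0) (htN : t N = T)
    (hmono : ∀ n < N, t n < t (n + 1))
    (Δ : ℝ)
    (hΔ : Δ = (Finset.range N).sup' (Finset.nonempty_range_iff.mpr hN.ne')
      (fun n => t (n + 1) - t n))
    (q : ENNReal) [Fact (1 ≤ q)] (m' : ℕ)
    (F : EuclideanSpace ℝ (Fin d) → PiLp q (fun _ : Fin m' => ℝ))
    (L₁ : NNReal) (hF : LipschitzWith L₁ F)
    (G Gθ Solver : EuclideanSpace ℝ (Fin d) → ℝ → ℝ → EuclideanSpace ℝ (Fin d))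
    (hGid : ∀ x, ∀ u ∈ Set.Icc (0:ℝ) T, G x u u = x)
    (hGsemi : ∀ x, ∀ s u v : ℝ, 0 ≤ s → s ≤ u → u ≤ v → v ≤ T →
      G (G x v u) u s = G x v s)
    (hGθid : ∀ x, ∀ u ∈ Set.Icc (0:ℝ) T, Gθ x u u = x)
    (L₂ : NNReal)
    (hGθlip : ∀ u ∈ Set.Icc (0:ℝ) T, ∀ s ∈ Set.Icc (0:ℝ) T,
      LipschitzWith L₂ (fun x => Gθ x u s))
    (C : ℝ) (p : ℕ) (hp : 1 ≤ p)
    (hSolver : ∀ x, ∀ n < N,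
      ‖Solver x (t (n + 1)) (t n) - G x (t (n + 1)) (t n)‖ ≤ C * (t (n + 1) - t n) ^ (p + 1))
    (hcons : ∀ x, ∀ n < N, ∀ k ≤ n,
      F (Gθ (Gθ x (t (n + 1)) (t k)) (t k) 0)
        = F (Gθ (Gθ (Solver x (t (n + 1)) (t n)) (t n) (t k)) (t k) 0)) :
    ∀ n, 1 ≤ n → n ≤ N → ∀ k ≤ n, ∀ x,
      ‖F (Gθ (Gθ x (t n) (t k)) (t k) 0) - F (Gθ (G x (t n) (t k)) (t k) 0)‖
        ≤ (L₁ : ℝ) * (L₂ : ℝ) ^ 2 * C * Δ ^ p * (t n - t k) := by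
  have hle : ∀ i j, i ≤ j → j ≤ N → t i ≤ t j := by
    intro i j hij
    induction j, hij using Nat.le_induction with
    | base => exact fun _ => le_rfl
    | succ j _ ih => exact fun hj => (ih (by omega)).trans (hmono j hj).le
  have hmem : ∀ i ≤ N, t i ∈ Set.Icc (0 : ℝ) T := fun i hi =>
    ⟨ht0 ▸ hle 0 i (Nat.zero_le i) hi, htN ▸ hle i N hi le_rfl⟩
  have hstep : ∀ n < N, t (n + 1) - t n ≤ Δ := fun n hn => hΔ ▸
    Finset.le_sup' (fun n => t (n + 1) - t n) (Finset.mem_range.mpr hn)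
  have hC : 0 ≤ C := nonneg_of_mul_nonneg_left
    ((norm_nonneg _).trans (hSolver 0 0 hN)) (pow_pos (sub_pos.mpr (hmono 0 hN)) _)
  intro n _ hn k hk
  induction n, hk using Nat.le_induction with
  | base =>
    intro x
    simp [hGid x _ (hmem k hn), hGθid x _ (hmem k hn)]
  | succ n hkn ih =>
    intro x
    have hnN : n < N := hn
    have h0 : (0 : ℝ) ∈ Set.Icc (0 : ℝ) T := ht0 ▸ hmem 0 (Nat.zero_le N)
    have hkm := hmem k (hkn.trans hnN.le)
    have hpos : 0 ≤ t (n + 1) - t n := sub_nonneg.mpr (hmono n hnN).le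
    have hlip : LipschitzWith (L₁ * (L₂ * L₂)) fun y => F (Gθ (Gθ y (t n) (t k)) (t k) 0) :=
      hF.comp ((hGθlip _ hkm 0 h0).comp (hGθlip _ (hmem n hnN.le) _ hkm))
    have hlocal := hlip.norm_sub_le (Solver x (t (n + 1)) (t n)) (G x (t (n + 1)) (t n))
    have hbound : ‖Solver x (t (n + 1)) (t n) - G x (t (n + 1)) (t n)‖
        ≤ C * (Δ ^ p * (t (n + 1) - t n)) := by
      refine (hSolver x n hnN).trans ?_
      rw [pow_succ]
      gcongr
      exact hstep n hnN
    have hprev : ‖F (Gθ (Gθ (G x (t (n + 1)) (t n)) (t n) (t k)) (t k) 0)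
        - F (Gθ (G x (t (n + 1)) (t k)) (t k) 0)‖
        ≤ (L₁ : ℝ) * (L₂ : ℝ) ^ 2 * C * Δ ^ p * (t n - t k) := by
      rw [← hGsemi x (t k) (t n) (t (n + 1)) hkm.1 (hle k n hkn hnN.le)
        (hmono n hnN).le (hmem (n + 1) hn).2]
      rcases Nat.eq_zero_or_pos n with rfl | hn0
      · obtain rfl : k = 0 := Nat.le_zero.mp hkn
        simp [hGid _ _ hkm, hGθid _ _ hkm]
      · exact ih hn0 hnN.le _
    rw [hcons x n hnN k hkn]
    calc _ ≤ _ := norm_sub_le_norm_sub_add_norm_sub _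
            (F (Gθ (Gθ (G x (t (n + 1)) (t n)) (t n) (t k)) (t k) 0)) _
      _ ≤ ↑(L₁ * (L₂ * L₂)) * (C * (Δ ^ p * (t (n + 1) - t n)))
          + (L₁ : ℝ) * (L₂ : ℝ) ^ 2 * C * Δ ^ p * (t n - t k) :=
        add_le_add (hlocal.trans (by gcongr)) hprev
      _ = _ := by push_cast; ring
end

section
/- Fix T > 0, γ ∈ [0,1], and sampling times T = t_0 > t_1 > ⋯ > t_N = 0. Let {p_u}_{u∈[0,T]} be probability measures on ℝ^D, let {𝒯_{u→s}} be measurable maps (oracle transitions) satisfying 𝒯_{u→s}♯p_u = p_s and the composition identities 𝒯_{√(1−γ²)t_{n+1}→t_{n+1}} ∘ 𝒯_{t_n→√(1−γ²)t_{n+1}} = 𝒯_{t_n→t_{n+1}}, and let {𝒯^θ_{u→s}} be measurable maps satisfying the one-step guarantee D_TV(𝒯_{u→s}♯p_u, 𝒯^θ_{u→s}♯p_u) ≤ C·√(u−s) for all 0 ≤ s < u ≤ T. Define the N-step γ-sampling output p_{θ,N} := (∘_{n=0}^{N−1} (𝒯_{√(1−γ²)t_{n+1}→t_{n+1}} ∘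 𝒯^θ_{t_n→√(1−γ²)t_{n+1}}))♯p_T, where the composition is applied sequentially from n = 0 to n = N−1. Then D_TV(p_data, p_{θ,N}) ≤ C·Σ_{n=0}^{N−1} √(t_n − √(1−γ²)·t_{n+1}). -/
open MeasureTheory

/-- Total variation distance `D_TV(μ,ν) = sup_{A measurable} |μ(A) - ν(A)|`. -/
noncomputable def tvDist {α : Type*} [MeasurableSpace α] (μ ν : Measure α) : ℝ :=
  ⨆ (A : Set α) (_ : MeasurableSet A), |(μ A).toReal - (ν A).toReal|

/-- `compSeq f n = f (n-1) ∘ ⋯ ∘ f 0` (sequential composition of the first `n` maps). -/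
def compSeq {α : Type*} (f : ℕ → α → α) : ℕ → α → α
  | 0 => id
  | n + 1 => f n ∘ compSeq f n

section TotalVariation

variable {α β : Type*} [MeasurableSpace α] [MeasurableSpace β]

theorem tvDist_le {μ ν : Measure α} {r : ℝ} (hr : 0 ≤ r)
    (h : ∀ A, MeasurableSet A → |(μ A).toReal - (ν A).toReal| ≤ r) : tvDist μ ν ≤ r :=
  Real.iSup_le (fun A => Real.iSup_le (h A) hr) hr

theorem tvDist_nonneg (μ ν : Measure α) : 0 ≤ tvDist μ ν :=
  Real.iSup_nonneg fun _ => Real.iSup_nonneg fun _ => abs_nonneg _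

theorem abs_measure_sub_le_tvDist (μ ν : Measure α) [IsProbabilityMeasure μ]
    [IsProbabilityMeasure ν] {A : Set α} (hA : MeasurableSet A) :
    |(μ A).toReal - (ν A).toReal| ≤ tvDist μ ν := by
  have hbdd : BddAbove (Set.range fun A : Set α =>
      ⨆ _ : MeasurableSet A, |(μ A).toReal - (ν A).toReal|) := by
    refine ⟨1, ?_⟩
    rintro _ ⟨B, rfl⟩
    refine Real.iSup_le (fun _ => ?_) zero_le_one
    exact abs_sub_le_of_nonneg_of_le ENNReal.toReal_nonneg (measureReal_le_one (μ := μ))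
      ENNReal.toReal_nonneg (measureReal_le_one (μ := ν))
  refine le_trans ?_ (le_ciSup hbdd A)
  simp [hA]

theorem tvDist_self (μ : Measure α) : tvDist μ μ = 0 :=
  le_antisymm (tvDist_le le_rfl (by simp)) (tvDist_nonneg μ μ)

theorem tvDist_triangle (μ ν ρ : Measure α) [IsProbabilityMeasure μ] [IsProbabilityMeasure ν]
    [IsProbabilityMeasure ρ] : tvDist μ ρ ≤ tvDist μ ν + tvDist ν ρ :=
  tvDist_le (add_nonneg (tvDist_nonneg μ ν) (tvDist_nonneg ν ρ)) fun _ hA =>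
    (abs_sub_le _ _ _).trans
      (add_le_add (abs_measure_sub_le_tvDist μ ν hA) (abs_measure_sub_le_tvDist ν ρ hA))

theorem tvDist_map_le (μ ν : Measure α) [IsProbabilityMeasure μ] [IsProbabilityMeasure ν]
    {f : α → β} (hf : Measurable f) : tvDist (μ.map f) (ν.map f) ≤ tvDist μ ν :=
  tvDist_le (tvDist_nonneg μ ν) fun A hA => by
    rw [Measure.map_apply hf hA, Measure.map_apply hf hA]
    exact abs_measure_sub_le_tvDist μ ν (hf hA)

theorem measurable_compSeq {f : ℕ → α → α} (hf : ∀ n, Measurable (f n)) (n : ℕ) :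
    Measurable (compSeq f n) := by
  induction n with
  | zero => exact measurable_id
  | succ n ih => exact (hf n).comp ih

end TotalVariation

/-- Accumulated errors of N-step γ-sampling: with sampling times
`T = t 0 > t 1 > ⋯ > t N = 0`, oracle transitions `Tr` satisfying marginal preservation
`Tr_{u→s}♯p_u = p_s` and the composition identities, and model transitions `Trθ` with
one-step guarantee `D_TV(Tr_{u→s}♯p_u, Trθ_{u→s}♯p_u) ≤ C √(u-s)`, the N-step γ-sampling
output `p_{θ,N} = (∘_{n=0}^{N-1}(Tr_{√(1-γ²)t_{n+1}→t_{n+1}} ∘ Trθ_{t_n→√(1-γ²)t_{n+1}}))♯p_T`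
satisfies `D_TV(p_data, p_{θ,N}) ≤ C ∑_{n<N} √(t n - √(1-γ²) t (n+1))`. -/
theorem stmt13 (d : ℕ) (T : ℝ) (hT : 0 < T) (γ : ℝ) (hγ : γ ∈ Set.Icc (0:ℝ) 1)
    (N : ℕ) (t : ℕ → ℝ) (ht0 : t 0 = T) (htN : t N = 0)
    (hdec : ∀ n < N, t (n + 1) < t n)
    (p : ℝ → Measure (EuclideanSpace ℝ (Fin d)))
    (hprob : ∀ u ∈ Set.Icc (0:ℝ) T, IsProbabilityMeasure (p u))
    (Tr Trθ : ℝ → ℝ → EuclideanSpace ℝ (Fin d) → EuclideanSpace ℝ (Fin d))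
    (hTr : ∀ u s, Measurable (Tr u s)) (hTrθ : ∀ u s, Measurable (Trθ u s))
    (hmarg : ∀ s u : ℝ, 0 ≤ s → s ≤ u → u ≤ T → (p u).map (Tr u s) = p s)
    (hcomp : ∀ n < N,
      Tr (Real.sqrt (1 - γ ^ 2) * t (n + 1)) (t (n + 1))
          ∘ Tr (t n) (Real.sqrt (1 - γ ^ 2) * t (n + 1))
        = Tr (t n) (t (n + 1)))
    (C : ℝ)
    (hstep : ∀ s u : ℝ, 0 ≤ s → s < u → u ≤ T →
      tvDist ((p u).map (Tr u s)) ((p u).map (Trθ u s)) ≤ C * Real.sqrt (u - s))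
    (pθN : Measure (EuclideanSpace ℝ (Fin d)))
    (hpθN : pθN = (p T).map (compSeq (fun n =>
      Tr (Real.sqrt (1 - γ ^ 2) * t (n + 1)) (t (n + 1))
        ∘ Trθ (t n) (Real.sqrt (1 - γ ^ 2) * t (n + 1))) N)) :
    tvDist (p 0) pθN
      ≤ C * ∑ n ∈ Finset.range N, Real.sqrt (t n - Real.sqrt (1 - γ ^ 2) * t (n + 1)) := by
  set c := Real.sqrt (1 - γ ^ 2)
  have hc0 : 0 ≤ c := Real.sqrt_nonneg _
  have hc1 : c ≤ 1 := Real.sqrt_le_one.mpr (by nlinarith [sq_nonneg γ])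
  have hanti : ∀ m n, m ≤ n → n ≤ N → t n ≤ t m := by
    intro m n hmn
    induction n, hmn using Nat.le_induction with
    | base => exact fun _ => le_rfl
    | succ n _ ih => exact fun h => (hdec n h).le.trans (ih (Nat.le_of_succ_le h))
  have ht_nonneg : ∀ n ≤ N, 0 ≤ t n := fun n hn => htN ▸ hanti n N hn le_rfl
  have ht_le : ∀ n ≤ N, t n ≤ T := fun n hn => ht0 ▸ hanti 0 n n.zero_le hn
  set f := fun n => Tr (c * t (n + 1)) (t (n + 1)) ∘ Trθ (t n) (c * t (n + 1)) with hf_def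
  have hf : ∀ n, Measurable (f n) := fun n => (hTr _ _).comp (hTrθ _ _)
  have hbound : ∀ n ≤ N, tvDist (p (t n)) ((p T).map (compSeq f n))
      ≤ C * ∑ i ∈ Finset.range n, Real.sqrt (t i - c * t (i + 1)) := by
    intro n
    induction n with
    | zero => simp [compSeq, ht0, tvDist_self]
    | succ n ih =>
      intro hn
      have hn' : n ≤ N := Nat.le_of_succ_le hn
      have hs0 : 0 ≤ c * t (n + 1) := mul_nonneg hc0 (ht_nonneg _ hn)
      have hs_lt : c * t (n + 1) < t n :=
        (mul_le_of_le_one_left (ht_nonneg _ hn) hc1).trans_lt (hdec n hn)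
      have := hprob T ⟨hT.le, le_rfl⟩
      have := hprob (t n) ⟨ht_nonneg n hn', ht_le n hn'⟩
      have := hprob (t (n + 1)) ⟨ht_nonneg _ hn, ht_le _ hn⟩
      have hmq := measurable_compSeq hf n
      have := Measure.isProbabilityMeasure_map (μ := p T) hmq.aemeasurable
      have := Measure.isProbabilityMeasure_map (μ := p (t n)) (hf n).aemeasurable
      have := Measure.isProbabilityMeasure_map (μ := (p T).map (compSeq f n)) (hf n).aemeasurable
      have := Measure.isProbabilityMeasure_map (μ := p (t n))
        (hTr (t n) (c * t (n + 1))).aemeasurable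
      have := Measure.isProbabilityMeasure_map (μ := p (t n))
        (hTrθ (t n) (c * t (n + 1))).aemeasurable
      have horacle : tvDist (p (t (n + 1))) ((p (t n)).map (f n))
          ≤ C * Real.sqrt (t n - c * t (n + 1)) := by
        rw [← hmarg (t (n + 1)) (t n) (ht_nonneg _ hn) (hdec n hn).le (ht_le n hn'),
          ← hcomp n hn, ← Measure.map_map (hTr _ _) (hTr _ _), hf_def,
          ← Measure.map_map (hTr _ _) (hTrθ _ _)]
        exact (tvDist_map_le _ _ (hTr _ _)).trans (hstep _ _ hs0 hs_lt (ht_le n hn'))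
      have hprop := tvDist_map_le (p (t n)) ((p T).map (compSeq f n)) (hf n)
      have hsucc : (p T).map (compSeq f (n + 1)) = ((p T).map (compSeq f n)).map (f n) :=
        (Measure.map_map (hf n) hmq).symm
      rw [hsucc, Finset.sum_range_succ, mul_add]
      linarith [tvDist_triangle (p (t (n + 1))) ((p (t n)).map (f n))
        (((p T).map (compSeq f n)).map (f n)), ih hn']
  rw [hpθN, ← htN]
  exact hbound N le_rfl
end
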